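/- Let W be a nonempty finite type, c : W → ℝ with 0 < c w for all w, and let f : ℕ → (W → ℝ) be a sequence such that for every t and every w ∈ W, P_{f (t+1)} w = Q_{f t} w (exact posterior updates). Then the sequence of marginal log-likelihoods t ↦ Real.log (L(f t)) is monotone nondecreasing: for all t, Real.log (L(f t)) ≤ Real.log (L(f (t+1))). -/

import Mathlib

/-- The softmax (Gibbs) distribution associated with logits `f`. -/
noncomputable def softmax {W : Type*} [Fintype W] (f : W → ℝ) (w : W) : ℝ :=
  Real.exp (f w) / ∑ w', Real.exp (f w')

/-- The log-partition function of the logits `f`. -/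
noncomputable def logPartition {W : Type*} [Fintype W] (f : W → ℝ) : ℝ :=
  Real.log (∑ w, Real.exp (f w))

/-- Kullback–Leibler divergence between finitely supported densities `p` and `q`
(with the convention `0 * log 0 = 0`, which holds definitionally in `ℝ`). -/
noncomputable def KLdiv {W : Type*} [Fintype W] (p q : W → ℝ) : ℝ :=
  ∑ w, p w * Real.log (p w / q w)

/-- Marginal likelihood: the `c`-weighted total mass of the softmax distribution of `f`. -/
noncomputable def margL {W : Type*} [Fintype W] (c f : W → ℝ) : ℝ :=
  ∑ w, c w * softmax f w

/-- Posterior distribution obtained by reweighting the softmax distribution of `f`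
by the evaluation weights `c` and normalizing. -/
noncomputable def post {W : Type*} [Fintype W] (c f : W → ℝ) (w : W) : ℝ :=
  c w * softmax f w / margL c f

theorem softmax_pos {W : Type*} [Fintype W] (f : W → ℝ) (w : W) : 0 < softmax f w :=
  div_pos (Real.exp_pos _)
    (Finset.sum_pos (fun _ _ => Real.exp_pos _) ⟨w, Finset.mem_univ w⟩)

theorem sum_softmax {W : Type*} [Fintype W] [Nonempty W] (f : W → ℝ) :
    ∑ w, softmax f w = 1 := by
  simp only [softmax, ← Finset.sum_div]
  exact div_self (Finset.sum_pos (fun _ _ => Real.exp_pos _) Finset.univ_nonempty).ne'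

theorem margL_pos {W : Type*} [Fintype W] [Nonempty W] {c : W → ℝ} (hc : ∀ w, 0 < c w)
    (f : W → ℝ) : 0 < margL c f :=
  Finset.sum_pos (fun w _ => mul_pos (hc w) (softmax_pos f w)) Finset.univ_nonempty

/-- The squared mean of `c` under the softmax distribution is at most its second moment. -/
theorem margL_sq_le {W : Type*} [Fintype W] [Nonempty W] (c f : W → ℝ) :
    margL c f ^ 2 ≤ ∑ w, c w ^ 2 * softmax f w := by
  have h := Finset.sum_sq_le_sum_mul_sum_of_sq_le_mul Finset.univ
    (r := fun w => c w * softmax f w) (f := fun w => c w ^ 2 * softmax f w) (g := softmax f)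
    (fun w _ => mul_nonneg (sq_nonneg _) (softmax_pos f w).le)
    (fun w _ => (softmax_pos f w).le) (fun w _ => le_of_eq (by ring))
  rwa [sum_softmax, mul_one] at h

/-- Along a sequence of exact posterior updates, the marginal log-likelihood is
monotone nondecreasing. -/
theorem log_margL_monotone {W : Type*} [Fintype W] [Nonempty W]
    (c : W → ℝ) (hc : ∀ w, 0 < c w) (f : ℕ → W → ℝ)
    (hupd : ∀ t, ∀ w, softmax (f (t + 1)) w = post c (f t) w) :
    ∀ t, Real.log (margL c (f t)) ≤ Real.log (margL c (f (t + 1))) := by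
  intro t
  have hL := margL_pos hc (f t)
  refine Real.log_le_log hL ?_
  have hnext : margL c (f (t + 1)) = (∑ w, c w ^ 2 * softmax (f t) w) / margL c (f t) := by
    rw [margL, Finset.sum_div]
    refine Finset.sum_congr rfl fun w _ => ?_
    rw [hupd, post]
    ring
  rw [hnext, le_div_iff₀ hL, ← sq]
  exact margL_sq_le c (f t)
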